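/- There exists a universal constant C > 0 such that for every finite set M and every family V = {v_1, …, v_n} of n ≥ 2 arbitrary valuation functions v_i : 2^M → ℝ (no marginal bound or monotonicity assumed), the two-color transfer-discrepancy satisfies disc^T(V, 2) ≤ C·√(n·log(2n)). That is, there exists a bipartition M = S ∪ S^c such that for every agent i, at most C·√(n·log(2n)) items need to be transferred between S and S^c to reverse the inequality between v_i(S) and v_i(S^c). -/

import Mathlib

/-- `transferAux v A B` is the minimum of `|S| + |S'|` over `S ⊆ A`, `S' ⊆ B`
with `v ((A \ S) ∪ S') ≤ v ((B \ S') ∪ S)` (intended for `v A ≥ v B`). -/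
noncomputable def transferAux {α : Type*} [Fintype α] [DecidableEq α]
    (v : Finset α → ℝ) (A B : Finset α) : ℕ :=
  sInf {t : ℕ | ∃ S S' : Finset α, S ⊆ A ∧ S' ⊆ B ∧
    v ((A \ S) ∪ S') ≤ v ((B \ S') ∪ S) ∧ t = S.card + S'.card}

/-- The transfer imbalance `T_v(A, B)`: if `v A ≥ v B` it is the least number of
items that must be exchanged between `A` and `B` to reverse the inequality;
otherwise `T_v(A, B) = T_v(B, A)`. -/
noncomputable def transferImbalance {α : Type*} [Fintype α] [DecidableEq α]
    (v : Finset α → ℝ) (A B : Finset α) : ℕ :=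
  if v B ≤ v A then transferAux v A B else transferAux v B A

/-- The simplicial coboundary modulo 2 of a cochain on ordered tuples of points. -/
def coboundary {V : Type*} : (List V → ZMod 2) → List V → ZMod 2
  | _, [] => 0
  | φ, v :: l => φ l + coboundary (fun t => φ (v :: t)) l

/-- The dual of the prism operator of a homotopy step from `f` to `g`. -/
def prism {V : Type*} (f g : V → V) : (List V → ZMod 2) → List V → ZMod 2
  | _, [] => 0
  | φ, v :: l => φ (f v :: g v :: l.map g) + prism f g (fun t => φ (f v :: t)) l

section Cochains

variable {V : Type*}

lemma coboundary_add (φ ψ : List V → ZMod 2) :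
    coboundary (φ + ψ) = coboundary φ + coboundary ψ := by
  funext l
  induction l generalizing φ ψ with
  | nil => simp [coboundary]
  | cons v l ih =>
    have := ih (fun t => φ (v :: t)) (fun t => ψ (v :: t))
    simp only [coboundary, Pi.add_apply] at this ⊢
    rw [show (fun t => φ (v :: t) + ψ (v :: t)) =
      (fun t => φ (v :: t)) + fun t => ψ (v :: t) from rfl, this]
    ring

lemma coboundary_const_mul (c : ZMod 2) (φ : List V → ZMod 2) (l : List V) :
    coboundary (fun t => c * φ t) l = c * coboundary φ l := by
  induction l generalizing φ with
  | nil => simp [coboundary]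
  | cons v l ih => simp [coboundary, ih, mul_add]

lemma coboundary_coboundary (φ : List V → ZMod 2) : coboundary (coboundary φ) = 0 := by
  funext l
  induction l generalizing φ with
  | nil => rfl
  | cons v l ih =>
    have h : (fun t => coboundary φ (v :: t)) = φ + coboundary (fun t => φ (v :: t)) := rfl
    rw [coboundary, h, coboundary_add, Pi.add_apply, ih, Pi.zero_apply, add_zero,
      CharTwo.add_self_eq_zero, Pi.zero_apply]

lemma coboundary_comp_map (g : V → V) (φ : List V → ZMod 2) (l : List V) :
    coboundary (fun t => φ (t.map g)) l = coboundary φ (l.map g) := by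
  induction l generalizing φ with
  | nil => rfl
  | cons v l ih =>
    simpa [coboundary] using ih (fun t => φ (g v :: t))

lemma prism_add (f g : V → V) (φ ψ : List V → ZMod 2) :
    prism f g (φ + ψ) = prism f g φ + prism f g ψ := by
  funext l
  induction l generalizing φ ψ with
  | nil => simp [prism]
  | cons v l ih =>
    have := ih (fun t => φ (f v :: t)) (fun t => ψ (f v :: t))
    simp only [prism, Pi.add_apply] at this ⊢
    rw [show (fun t => φ (f v :: t) + ψ (f v :: t)) =
      (fun t => φ (f v :: t)) + fun t => ψ (f v :: t) from rfl, this]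
    ring

/-- The homotopy formula for the prism operator. -/
lemma prism_coboundary (f g : V → V) (φ : List V → ZMod 2) (l : List V) :
    prism f g (coboundary φ) l + coboundary (prism f g φ) l = φ (l.map f) + φ (l.map g) := by
  induction l generalizing φ with
  | nil => simp [prism, coboundary, CharTwo.add_self_eq_zero]
  | cons v l ih =>
    have h₁ : (fun t => coboundary φ (f v :: t)) = φ + coboundary (fun t => φ (f v :: t)) := rfl
    have h₂ : (fun t => prism f g φ (v :: t)) =
        (fun t => φ (f v :: g v :: t.map g)) + prism f g (fun t => φ (f v :: t)) := rfl
    have h₃ := coboundary_comp_map g (fun t => φ (f v :: g v :: t)) l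
    have h₄ := ih (fun t => φ (f v :: t))
    have h₅ : prism f g (coboundary φ) (v :: l) =
        φ (g v :: l.map g) + (φ (f v :: l.map g) +
          coboundary (fun t => φ (f v :: g v :: t)) (l.map g)) +
        prism f g (fun t => coboundary φ (f v :: t)) l := rfl
    have h₆ : coboundary (prism f g φ) (v :: l) =
        prism f g φ l + coboundary (fun t => prism f g φ (v :: t)) l := rfl
    rw [h₅, h₆, h₁, h₂, prism_add, coboundary_add, Pi.add_apply, Pi.add_apply, h₃,
      List.map_cons, List.map_cons]
    generalize prism f g (coboundary fun t => φ (f v :: t)) l = a at *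
    generalize coboundary (prism f g fun t => φ (f v :: t)) l = b at *
    generalize coboundary (fun t => φ (f v :: g v :: t)) (l.map g) = c at *
    generalize prism f g φ l = d at *
    generalize φ (f v :: l.map f) = e at *
    generalize φ (f v :: l.map g) = p at *
    generalize φ (g v :: l.map g) = q at *
    clear * - h₄
    revert a b c d e p q
    decide

lemma prism_eq_zero (f g : V → V) (φ : List V → ZMod 2) (l : List V)
    (h : ∀ t, (∀ u ∈ t, ∃ v ∈ l, u = f v ∨ u = g v) → φ t = 0) : prism f g φ l = 0 := by
  induction l generalizing φ with
  | nil => rfl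
  | cons v l ih =>
    rw [prism, h, ih, add_zero]
    · intro t ht
      apply h
      simp only [List.mem_cons, forall_eq_or_imp, exists_eq_or_imp]
      exact ⟨by simp, fun u hu => .inr (ht u hu)⟩
    · simp only [List.mem_cons, List.mem_map]
      rintro u (rfl | rfl | ⟨w, hw, rfl⟩)
      · exact ⟨v, by simp⟩
      · exact ⟨v, by simp⟩
      · exact ⟨w, by simp [hw]⟩

/-- The dual of the chain contraction given by a discrete homotopy `F 0, …, F T`. -/
def contraction (F : ℕ → V → V) (T : ℕ) (φ : List V → ZMod 2) (l : List V) : ZMod 2 :=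
  ∑ s ∈ Finset.range T, prism (F s) (F (s + 1)) φ l

lemma coboundary_sum {ι : Type*} (S : Finset ι) (φ : ι → List V → ZMod 2) (l : List V) :
    coboundary (fun t => ∑ s ∈ S, φ s t) l = ∑ s ∈ S, coboundary (φ s) l := by
  induction l generalizing φ with
  | nil => simp [coboundary]
  | cons v l ih => simp [coboundary, ih, Finset.sum_add_distrib]

lemma contraction_coboundary (F : ℕ → V → V) (T : ℕ) (φ : List V → ZMod 2) (l : List V) :
    contraction F T (coboundary φ) l + coboundary (contraction F T φ) l =
      φ (l.map (F 0)) + φ (l.map (F T)) := by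
  have h : coboundary (contraction F T φ) l =
      ∑ s ∈ Finset.range T, coboundary (prism (F s) (F (s + 1)) φ) l := coboundary_sum ..
  rw [h, contraction, ← Finset.sum_add_distrib]
  simp only [prism_coboundary]
  clear h
  induction T with
  | zero => simp [CharTwo.add_self_eq_zero]
  | succ T ih =>
    rw [Finset.sum_range_succ, ih, add_assoc, ← add_assoc (φ (l.map (F T))),
      CharTwo.add_self_eq_zero, zero_add]

lemma contraction_add (F : ℕ → V → V) (T : ℕ) (φ ψ : List V → ZMod 2) :
    contraction F T (φ + ψ) = contraction F T φ + contraction F T ψ := by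
  funext l
  simp [contraction, prism_add, Finset.sum_add_distrib]

lemma cochain_add_self (φ : List V → ZMod 2) : φ + φ = 0 := by
  funext l
  exact CharTwo.add_self_eq_zero _

/-- Multiplication of a cochain by a function of the first point. -/
def headMul (s : V → ZMod 2) (ψ : List V → ZMod 2) : List V → ZMod 2
  | [] => 0
  | v :: l => s v * ψ (v :: l)

/-- The cup product of the coboundaries of the given functions. -/
def cupCoboundary : List (V → ZMod 2) → List V → ZMod 2
  | [] => fun l => if l.length = 1 then 1 else 0
  | s :: ss => coboundary (headMul s (cupCoboundary ss))

lemma cupCoboundary_nil (ss : List (V → ZMod 2)) : cupCoboundary ss [] = 0 := by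
  cases ss <;> rfl

lemma coboundary_cupCoboundary (ss : List (V → ZMod 2)) : coboundary (cupCoboundary ss) = 0 := by
  cases ss with
  | cons s ss => exact coboundary_coboundary _
  | nil =>
    funext l
    match l with
    | [] => rfl
    | [_] => rfl
    | [_, _] => simp [coboundary, cupCoboundary, CharTwo.add_self_eq_zero]
    | u :: v :: w :: l =>
      have h : ∀ l : List V, coboundary (fun _ => (0 : ZMod 2)) l = 0 := fun l => by
        simpa using coboundary_const_mul 0 (fun _ => 0) l
      simp [coboundary, cupCoboundary, h]

lemma cupCoboundary_cons_cons (s : V → ZMod 2) (ss : List (V → ZMod 2)) (v w : V) (l : List V) :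
    cupCoboundary (s :: ss) (v :: w :: l) = (s v + s w) * cupCoboundary ss (w :: l) := by
  have h := congrFun (coboundary_cupCoboundary ss) (v :: w :: l)
  rw [coboundary, Pi.zero_apply] at h
  rw [cupCoboundary, coboundary]
  simp only [headMul]
  rw [coboundary_const_mul, ← CharTwo.add_eq_zero.1 h]
  ring

lemma exists_ne_of_cupCoboundary_ne_zero (ss : List (V → ZMod 2)) (l : List V)
    (h : cupCoboundary ss l ≠ 0) : ∀ s ∈ ss, ∃ v ∈ l, ∃ w ∈ l, s v ≠ s w := by
  induction ss generalizing l with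
  | nil => simp
  | cons s ss ih =>
    match l, h with
    | [], h => exact absurd rfl h
    | [v], h => exact absurd rfl h
    | v :: w :: l, h =>
      rw [cupCoboundary_cons_cons] at h
      rintro r (_ | ⟨_, hr⟩)
      · refine ⟨v, by simp, w, by simp, fun e => left_ne_zero_of_mul h ?_⟩
        rw [e, CharTwo.add_self_eq_zero]
      · obtain ⟨a, ha, b, hb, hab⟩ := ih _ (right_ne_zero_of_mul h) r hr
        exact ⟨a, .tail _ ha, b, .tail _ hb, hab⟩

variable [InvolutiveNeg V]

/-- Pairing of a cochain with the `k`-dimensional hemisphere obtained from the point `p` by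
iterating the contraction on the union of the previous hemisphere and its antipode. -/
def hemispherePairing (F : ℕ → V → V) (T : ℕ) (p : V) : ℕ → (List V → ZMod 2) → ZMod 2
  | 0, φ => φ [p]
  | k + 1, φ => hemispherePairing F T p k
      (contraction F T φ + fun l => contraction F T φ (l.map Neg.neg))

lemma hemispherePairing_add (F : ℕ → V → V) (T : ℕ) (p : V) (k : ℕ) (φ ψ : List V → ZMod 2) :
    hemispherePairing F T p k (φ + ψ) =
      hemispherePairing F T p k φ + hemispherePairing F T p k ψ := by
  induction k generalizing φ ψ with
  | zero => rfl
  | succ k ih =>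
    simp only [hemispherePairing, ← ih, contraction_add]
    congr 1
    funext l
    simp only [Pi.add_apply]
    ring

lemma map_neg_map_neg (l : List V) : (l.map Neg.neg).map Neg.neg = l := by
  simp

lemma hemispherePairing_zero (F : ℕ → V → V) (T : ℕ) (p : V) (k : ℕ) :
    hemispherePairing F T p k 0 = 0 := by
  rw [← cochain_add_self 0, hemispherePairing_add, CharTwo.add_self_eq_zero]

/-- Stokes' formula: the boundary of a hemisphere is the union of the previous hemisphere and
its antipode. -/
lemma hemispherePairing_coboundary (F : ℕ → V → V) (T : ℕ) (p : V) (hT : F T = id)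
    (h0 : ∀ v w, F 0 v = F 0 w) (k : ℕ) (φ : List V → ZMod 2) :
    hemispherePairing F T p (k + 1) (coboundary φ) =
      hemispherePairing F T p k (φ + fun l => φ (l.map Neg.neg)) := by
  induction k generalizing φ with
  | zero =>
    have h₁ := contraction_coboundary F T φ [p]
    have h₂ := contraction_coboundary F T φ [-p]
    simp only [hT, coboundary, List.map_cons, List.map_nil, id_eq, add_zero, h0 (-p) p] at h₁ h₂
    simp only [hemispherePairing, Pi.add_apply, List.map_cons, List.map_nil]
    generalize contraction F T (coboundary φ) [p] = a at *
    generalize contraction F T (coboundary φ) [-p] = b at *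
    generalize contraction F T φ [] = c at *
    generalize φ [F 0 p] = d at *
    generalize φ [p] = e at *
    generalize φ [-p] = q at *
    clear * - h₁ h₂
    revert a b c d e q
    decide
  | succ k ih =>
    set ψ := contraction F T φ with hψ
    have key : (contraction F T (coboundary φ) +
          fun l => contraction F T (coboundary φ) (l.map Neg.neg)) =
        (φ + fun l => φ (l.map Neg.neg)) + coboundary (ψ + fun l => ψ (l.map Neg.neg)) := by
      funext l
      have h₁ := contraction_coboundary F T φ l
      have h₂ := contraction_coboundary F T φ (l.map Neg.neg)
      have h₃ : (l.map Neg.neg).map (F 0) = l.map (F 0) := by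
        rw [List.map_map]
        exact List.map_congr_left fun v _ => h0 _ _
      simp only [hT, List.map_id, h₃, ← hψ] at h₁ h₂
      simp only [coboundary_add, Pi.add_apply, coboundary_comp_map]
      generalize contraction F T (coboundary φ) l = a at *
      generalize contraction F T (coboundary φ) (l.map Neg.neg) = b at *
      generalize coboundary ψ l = c at *
      generalize coboundary ψ (l.map Neg.neg) = d at *
      generalize φ (l.map (F 0)) = e at *
      generalize φ l = q at *
      generalize φ (l.map Neg.neg) = r at *
      clear * - h₁ h₂
      revert a b c d e q r
      decide
    rw [hemispherePairing, key, hemispherePairing_add, ih]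
    have hsym : (ψ + fun l : List V => ψ (l.map Neg.neg)) +
        (fun l : List V => (ψ + fun l : List V => ψ (l.map Neg.neg)) (l.map Neg.neg)) = 0 := by
      funext l
      simp only [Pi.add_apply, map_neg_map_neg, Pi.zero_apply]
      rw [add_comm (ψ (l.map Neg.neg)), CharTwo.add_self_eq_zero]
    rw [hsym, hemispherePairing_zero, add_zero]

lemma headMul_add_map_neg (s : V → ZMod 2) (hs : ∀ v, s (-v) = s v + 1) (ψ : List V → ZMod 2)
    (hψ : ∀ l, ψ (l.map Neg.neg) = ψ l) (hnil : ψ [] = 0) :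
    (headMul s ψ + fun l => headMul s ψ (l.map Neg.neg)) = ψ := by
  funext l
  cases l with
  | nil => simp [headMul, hnil]
  | cons v l =>
    have := hψ (v :: l)
    simp only [List.map_cons] at this
    simp only [Pi.add_apply, List.map_cons, headMul, hs, this]
    linear_combination CharTwo.add_self_eq_zero (s v * ψ (v :: l))

lemma cupCoboundary_map_neg (ss : List (V → ZMod 2)) (hss : ∀ s ∈ ss, ∀ v, s (-v) = s v + 1)
    (l : List V) : cupCoboundary ss (l.map Neg.neg) = cupCoboundary ss l := by
  induction ss generalizing l with
  | nil => simp [cupCoboundary]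
  | cons s ss ih =>
    have h := congrArg (fun φ => coboundary φ l) (headMul_add_map_neg s (hss s (by simp)) _
      (ih fun r hr => hss r (.tail _ hr)) (cupCoboundary_nil ss))
    simp only [coboundary_add, Pi.add_apply, coboundary_comp_map, coboundary_cupCoboundary,
      Pi.zero_apply] at h
    exact (CharTwo.add_eq_zero.1 h).symm

lemma hemispherePairing_cupCoboundary (F : ℕ → V → V) (T : ℕ) (p : V) (hT : F T = id)
    (h0 : ∀ v w, F 0 v = F 0 w) (ss : List (V → ZMod 2))
    (hss : ∀ s ∈ ss, ∀ v, s (-v) = s v + 1) :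
    hemispherePairing F T p ss.length (cupCoboundary ss) = 1 := by
  induction ss with
  | nil => rfl
  | cons s ss ih =>
    have hss' := fun r hr => hss r (.tail _ hr)
    rw [List.length_cons, cupCoboundary, hemispherePairing_coboundary F T p hT h0,
      headMul_add_map_neg s (hss s (by simp)) _ (cupCoboundary_map_neg ss hss')
        (cupCoboundary_nil ss), ih hss']

/-- A cochain vanishing on a family of tuples which contains the point `p` and is stable under
antipodes and prisms pairs trivially with the hemispheres. -/
lemma hemispherePairing_eq_zero (F : ℕ → V → V) (T : ℕ) (p : V) (G : ℕ → List V → Prop)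
    (hp : G 0 [p]) (hneg : ∀ k l, G k l → G k (l.map Neg.neg))
    (hF : ∀ k l, G k l → ∀ s t, (∀ u ∈ t, ∃ v ∈ l, u = F s v ∨ u = F (s + 1) v) → G (k + 1) t)
    (k : ℕ) (φ : List V → ZMod 2) (h : ∀ l, G k l → φ l = 0) :
    hemispherePairing F T p k φ = 0 := by
  induction k generalizing φ with
  | zero => exact h _ hp
  | succ k ih =>
    have hc : ∀ l, G k l → contraction F T φ l = 0 := fun l hl =>
      Finset.sum_eq_zero fun s _ => prism_eq_zero _ _ _ _ fun t ht => h t (hF k l hl s t ht)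
    refine ih _ fun l hl => ?_
    rw [Pi.add_apply, hc l hl, hc _ (hneg k l hl), add_zero]

end Cochains

section Cube

variable {α : Type*}

/-- The sign of an odd function on nonzero vectors, with ties broken antisymmetrically. -/
noncomputable def oddSign (g : (α → ℝ) → ℝ) (x : α → ℝ) : ZMod 2 :=
  open Classical in if 0 < g x ∨ g x = 0 ∧ WellOrderingRel x (-x) then 1 else 0

lemma oddSign_neg {g : (α → ℝ) → ℝ} (hg : ∀ x, g (-x) = -g x) {x : α → ℝ} (hx : x ≠ 0) :
    oddSign g (-x) = oddSign g x + 1 := by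
  have hne : x ≠ -x := fun h => hx (self_eq_neg.1 h)
  have htri := trichotomous_of WellOrderingRel x (-x)
  have hasymm : WellOrderingRel x (-x) → ¬ WellOrderingRel (-x) x := fun h h' => asymm h h'
  rw [oddSign, oddSign, hg, neg_neg]
  rcases lt_trichotomy (g x) 0 with h | h | h
  · rw [if_pos (.inl (by linarith)), if_neg, zero_add]
    rintro (h' | h') <;> linarith
  · by_cases hw : WellOrderingRel x (-x)
    · simp [h, hw, hasymm hw, CharTwo.add_self_eq_zero]
    · have : WellOrderingRel (-x) x := by tauto
      simp [h, hw, this]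
  · rw [if_neg, if_pos (.inl h), CharTwo.add_self_eq_zero]
    rintro (h' | h') <;> linarith

lemma exists_nonneg_nonpos_of_oddSign_ne {g : (α → ℝ) → ℝ} {x y : α → ℝ}
    (h : oddSign g x ≠ oddSign g y) : (0 ≤ g x ∧ g y ≤ 0) ∨ (0 ≤ g y ∧ g x ≤ 0) := by
  have h1 : ∀ z, 0 < g z → oddSign g z = 1 := fun z hz => if_pos (.inl hz)
  have h0 : ∀ z, g z < 0 → oddSign g z = 0 := fun z hz => if_neg (by
    rintro (h' | h') <;> linarith)
  by_contra! hc
  rcases lt_trichotomy (g x) 0 with hx | hx | hx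
  · have hy : g y < 0 := by by_contra! hy; linarith [hc.2 hy]
    exact h (by rw [h0 _ hx, h0 _ hy])
  · linarith [hc.1 hx.ge, hc.2 (hc.1 hx.ge).le]
  · have hy := hc.1 hx.le
    exact h (by rw [h1 _ hx, h1 _ hy])

instance : InvolutiveNeg {x : α → ℝ // x ≠ 0} where
  neg x := ⟨-x.1, neg_ne_zero.2 x.2⟩
  neg_neg x := Subtype.ext (neg_neg x.1)

variable [Fintype α]

/-- The coordinates of a point of the cube `[-1, 1]^α` which are not `±1`. -/
noncomputable def fractional (x : α → ℝ) : Finset α :=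
  Finset.univ.filter fun q => |x q| ≠ 1

lemma mem_fractional {x : α → ℝ} {q : α} : q ∈ fractional x ↔ |x q| ≠ 1 := by
  simp [fractional]

lemma fractional_neg (x : α → ℝ) : fractional (-x) = fractional x := by
  simp [fractional]

/-- The contraction of the cube towards the all-ones vertex with coordinatewise ratios `c`. -/
def contractTo (c x : α → ℝ) : α → ℝ := fun q => 1 + c q * (x q - 1)

lemma norm_contractTo_le {c x : α → ℝ} (h0 : ∀ q, 0 ≤ c q) (h1 : ∀ q, c q ≤ 1) (hx : ‖x‖ ≤ 1) :
    ‖contractTo c x‖ ≤ 1 := by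
  rw [pi_norm_le_iff_of_nonneg zero_le_one] at hx ⊢
  intro q
  obtain ⟨h₁, h₂⟩ := abs_le.1 (hx q)
  rw [Real.norm_eq_abs, abs_le, contractTo]
  constructor <;> nlinarith [h0 q, h1 q]

lemma dist_contractTo_le {c : α → ℝ} (h0 : ∀ q, 0 ≤ c q) (h1 : ∀ q, c q ≤ 1) (x y : α → ℝ) :
    dist (contractTo c x) (contractTo c y) ≤ dist x y := by
  refine (dist_pi_le_iff dist_nonneg).2 fun q => ?_
  refine le_trans ?_ (dist_le_pi_dist x y q)
  rw [Real.dist_eq, Real.dist_eq, contractTo, contractTo,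
    show 1 + c q * (x q - 1) - (1 + c q * (y q - 1)) = c q * (x q - y q) by ring, abs_mul,
    abs_of_nonneg (h0 q)]
  exact mul_le_of_le_one_left (abs_nonneg _) (h1 q)

lemma dist_contractTo_contractTo_le {c d x : α → ℝ} {η : ℝ} (hη : 0 ≤ η)
    (h : ∀ q, |c q - d q| ≤ η) (hx : ‖x‖ ≤ 1) :
    dist (contractTo c x) (contractTo d x) ≤ η * 2 := by
  refine (dist_pi_le_iff (by positivity)).2 fun q => ?_
  rw [pi_norm_le_iff_of_nonneg zero_le_one] at hx
  obtain ⟨h₁, h₂⟩ := abs_le.1 (hx q)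
  rw [Real.dist_eq, contractTo, contractTo,
    show 1 + c q * (x q - 1) - (1 + d q * (x q - 1)) = (c q - d q) * (x q - 1) by ring, abs_mul]
  exact mul_le_mul (h q) (abs_le.2 ⟨by linarith, by linarith⟩) (abs_nonneg _) hη

lemma card_fractional_contractTo_le {c : α → ℝ}
    (hc : ∀ p q, c p ≠ 0 → c p ≠ 1 → c q ≠ 0 → c q ≠ 1 → p = q) (x : α → ℝ) :
    (fractional (contractTo c x)).card ≤ (fractional x).card + 1 := by
  classical
  have h : fractional (contractTo c x) ⊆
      fractional x ∪ Finset.univ.filter fun q => c q ≠ 0 ∧ c q ≠ 1 := by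
    intro q
    simp only [mem_fractional, contractTo, Finset.mem_filter, Finset.mem_univ, true_and,
      Finset.mem_union]
    intro h
    by_cases h0 : c q = 0
    · simp [h0] at h
    by_cases h1 : c q = 1
    · exact .inl (by simpa [h1] using h)
    · exact .inr ⟨h0, h1⟩
  refine (Finset.card_le_card h).trans ((Finset.card_union_le _ _).trans ?_)
  gcongr
  refine Finset.card_le_one.2 fun p hp q hq => ?_
  simp only [Finset.mem_filter, Finset.mem_univ, true_and] at hp hq
  exact hc p q hp.1 hp.2 hq.1 hq.2

/-- Ratios of a discrete homotopy moving the coordinates one after another, in steps of `1 / N`. -/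
noncomputable def sweepRatio (N : ℕ) (s : ℕ) (q : α) : ℝ :=
  max 0 (min 1 ((s : ℝ) / N - Fintype.equivFin α q))

lemma sweepRatio_nonneg (N s : ℕ) (q : α) : 0 ≤ sweepRatio N s q := le_max_left _ _

lemma sweepRatio_le_one (N s : ℕ) (q : α) : sweepRatio N s q ≤ 1 :=
  max_le zero_le_one (min_le_left _ _)

lemma sweepRatio_zero (N : ℕ) (q : α) : sweepRatio N 0 q = 0 :=
  max_eq_left ((min_le_right _ _).trans (by simp))

lemma sweepRatio_last {N : ℕ} (hN : 0 < N) (q : α) :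
    sweepRatio N (Fintype.card α * N) q = 1 := by
  have h : ((Fintype.equivFin α q : ℕ) : ℝ) + 1 ≤ Fintype.card α := by
    exact_mod_cast (Fintype.equivFin α q).2
  have hN' : (N : ℝ) ≠ 0 := by positivity
  rw [sweepRatio, min_eq_left, max_eq_right zero_le_one]
  push_cast
  rw [mul_div_cancel_right₀ _ hN']
  linarith

lemma abs_sweepRatio_sub_le (N s : ℕ) (q : α) :
    |sweepRatio N s q - sweepRatio N (s + 1) q| ≤ 1 / N := by
  have h : ((s + 1 : ℕ) : ℝ) / N = s / N + 1 / N := by push_cast; ring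
  have hN : (0 : ℝ) ≤ 1 / N := by positivity
  rw [sweepRatio, sweepRatio, h]
  generalize (s : ℝ) / N = a at *
  generalize (1 : ℝ) / N = b at *
  simp only [max_def, min_def]
  split_ifs <;> rw [abs_le] <;> constructor <;> linarith

lemma sweepRatio_unique (N s : ℕ) (p q : α) (hp0 : sweepRatio N s p ≠ 0)
    (hp1 : sweepRatio N s p ≠ 1) (hq0 : sweepRatio N s q ≠ 0) (hq1 : sweepRatio N s q ≠ 1) :
    p = q := by
  have key : ∀ r : α, sweepRatio N s r ≠ 0 → sweepRatio N s r ≠ 1 →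
      ((Fintype.equivFin α r : ℕ) : ℝ) < s / N ∧ (s : ℝ) / N < (Fintype.equivFin α r : ℕ) + 1 := by
    intro r h0 h1
    constructor
    · by_contra! h
      exact h0 (max_eq_left ((min_le_right _ _).trans (by linarith)))
    · by_contra! h
      refine h1 ?_
      rw [sweepRatio, min_eq_left (by linarith), max_eq_right zero_le_one]
  obtain ⟨h₁, h₂⟩ := key p hp0 hp1
  obtain ⟨h₃, h₄⟩ := key q hq0 hq1
  have h₅ : (Fintype.equivFin α p : ℕ) < Fintype.equivFin α q + 1 := by
    exact_mod_cast h₁.trans h₄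
  have h₆ : (Fintype.equivFin α q : ℕ) < Fintype.equivFin α p + 1 := by
    exact_mod_cast h₃.trans h₂
  exact (Fintype.equivFin α).injective (Fin.ext (by omega))

/-- A Borsuk–Ulam theorem for skeleta of the cube: `n` odd continuous functions on the cube
nearly vanish simultaneously at a point with at most `n` fractional coordinates. -/
theorem exists_abs_le_of_odd {n : ℕ} (f : Fin n → (α → ℝ) → ℝ) (hf : ∀ i, Continuous (f i))
    (hodd : ∀ i x, f i (-x) = -f i x) {ε : ℝ} (hε : 0 < ε) :
    ∃ x : α → ℝ, ‖x‖ ≤ 1 ∧ (fractional x).card ≤ n ∧ ∀ i, |f i x| ≤ ε := by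
  rcases le_or_gt (Fintype.card α) n with hn | hn
  · refine ⟨0, by simp, (Finset.card_le_univ _).trans hn, fun i => ?_⟩
    have := hodd i 0
    rw [neg_zero, self_eq_neg] at this
    simp [this, hε.le]
  have hne : ∀ x : α → ℝ, (fractional x).card ≤ n → x ≠ 0 := by
    rintro x hx rfl
    have h : fractional (0 : α → ℝ) = Finset.univ := by simp [fractional]
    rw [h, Finset.card_univ] at hx
    omega
  have : Nonempty α := Fintype.card_pos_iff.1 (by omega)
  obtain ⟨δ, hδ, hfδ⟩ := Metric.uniformContinuousOn_iff.1
    ((isCompact_closedBall (0 : α → ℝ) 1).uniformContinuousOn_of_continuous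
      (continuous_pi hf).continuousOn) ε hε
  obtain ⟨N, hN⟩ := exists_nat_gt (n * 2 / δ)
  have hN0 : (0 : ℝ) < N := lt_of_le_of_lt (by positivity) hN
  have hNδ : n * (1 / N * 2) < δ := by
    rw [div_lt_iff₀ hδ] at hN
    rw [show (n : ℝ) * (1 / N * 2) = n * 2 / N by ring, div_lt_iff₀ hN0]
    linarith
  let p : {x : α → ℝ // x ≠ 0} := ⟨1, one_ne_zero⟩
  let F : ℕ → {x : α → ℝ // x ≠ 0} → {x : α → ℝ // x ≠ 0} := fun s x =>
    open Classical in
    if h : contractTo (sweepRatio N s) x.1 ≠ 0 then ⟨_, h⟩ else p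
  have hT : F (Fintype.card α * N) = id := by
    funext x
    have h : contractTo (sweepRatio N (Fintype.card α * N)) x.1 = x.1 := by
      funext q
      simp [contractTo, sweepRatio_last (Nat.cast_pos.1 hN0)]
    simp [F, h, x.2]
  have h0 : ∀ v w, F 0 v = F 0 w := by
    have h : ∀ x : α → ℝ, contractTo (sweepRatio N 0) x = 1 := fun x => by
      funext q
      simp [contractTo, sweepRatio_zero]
    intro v w
    simp [F, h]
  let ss : List ({x : α → ℝ // x ≠ 0} → ZMod 2) := List.ofFn fun i x => oddSign (f i) x.1
  have hss : ∀ s ∈ ss, ∀ v, s (-v) = s v + 1 := by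
    intro s hs v
    obtain ⟨i, rfl⟩ := List.mem_ofFn.1 hs
    exact oddSign_neg (hodd i) v.2
  let G : ℕ → List {x : α → ℝ // x ≠ 0} → Prop := fun k l => k ≤ n → ∀ v ∈ l,
    (‖v.1‖ ≤ 1 ∧ (fractional v.1).card ≤ k) ∧ ∀ w ∈ l, dist v.1 w.1 ≤ k * (1 / N * 2)
  have hpair := hemispherePairing_cupCoboundary F _ p hT h0 ss hss
  rw [show ss.length = n by simp [ss]] at hpair
  obtain ⟨l, hl, hcup⟩ : ∃ l, G n l ∧ cupCoboundary ss l ≠ 0 := by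
    by_contra! hcon
    refine one_ne_zero (hpair.symm.trans
      (hemispherePairing_eq_zero F _ p G ?_ ?_ ?_ n _ hcon))
    · intro _ v hv
      rw [List.mem_singleton] at hv
      subst hv
      simp [p, fractional]
    · intro k l hl hk v hv
      obtain ⟨v, hv', rfl⟩ := List.mem_map.1 hv
      obtain ⟨⟨h₁, h₂⟩, h₃⟩ := hl hk v hv'
      refine ⟨⟨(norm_neg v.1).trans_le h₁, (fractional_neg v.1).symm ▸ h₂⟩, fun w hw => ?_⟩
      obtain ⟨w, hw', rfl⟩ := List.mem_map.1 hw
      exact (dist_neg_neg v.1 w.1).trans_le (h₃ w hw')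
    · intro k l hl s t ht hk
      have hfrac : ∀ v ∈ l, ∀ r,
          (fractional (contractTo (sweepRatio N r) v.1)).card ≤ k + 1 := fun v hv r =>
        (card_fractional_contractTo_le (sweepRatio_unique N r) v.1).trans
          (Nat.succ_le_succ (hl (by omega) v hv).1.2)
      have hF : ∀ v ∈ l, ∀ r, (F r v).1 = contractTo (sweepRatio N r) v.1 := fun v hv r => by
        simp only [F]
        rw [dif_pos (hne _ ((hfrac v hv r).trans hk))]
      have hu : ∀ u ∈ t, ∃ v ∈ l, ∃ r, (r = s ∨ r = s + 1) ∧
          u.1 = contractTo (sweepRatio N r) v.1 := by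
        intro u hu
        obtain ⟨v, hv, rfl | rfl⟩ := ht u hu
        · exact ⟨v, hv, s, .inl rfl, hF v hv _⟩
        · exact ⟨v, hv, s + 1, .inr rfl, hF v hv _⟩
      intro u hut
      obtain ⟨v, hv, r, hr, huv⟩ := hu u hut
      have hv' := hl (by omega) v hv
      rw [huv]
      refine ⟨⟨norm_contractTo_le (sweepRatio_nonneg N r) (sweepRatio_le_one N r) hv'.1.1,
        hfrac v hv r⟩, fun u' hut' => ?_⟩
      obtain ⟨w, hw, r', hr', huw⟩ := hu u' hut'
      rw [huw]
      have h₁ := dist_contractTo_le (sweepRatio_nonneg N r) (sweepRatio_le_one N r) v.1 w.1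
      have h₂ : dist (contractTo (sweepRatio N r) w.1) (contractTo (sweepRatio N r') w.1) ≤
          1 / N * 2 := by
        refine dist_contractTo_contractTo_le (by positivity) (fun q => ?_)
          (hl (by omega) w hw).1.1
        rcases hr with rfl | rfl <;> rcases hr' with rfl | rfl
        · simp
        · exact abs_sweepRatio_sub_le N _ q
        · rw [abs_sub_comm]
          exact abs_sweepRatio_sub_le N _ q
        · simp
      have h₃ := hv'.2 w hw
      have h₄ := dist_triangle (contractTo (sweepRatio N r) v.1)
        (contractTo (sweepRatio N r) w.1) (contractTo (sweepRatio N r') w.1)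
      push_cast
      linarith
  have hl := hl le_rfl
  obtain ⟨u, hu⟩ : ∃ u, u ∈ l := by
    refine List.exists_mem_of_ne_nil l ?_
    rintro rfl
    exact hcup (cupCoboundary_nil ss)
  refine ⟨u.1, (hl u hu).1.1, (hl u hu).1.2, fun i => ?_⟩
  have hclose : ∀ v ∈ l, |f i u.1 - f i v.1| < ε := fun v hv =>
    (dist_le_pi_dist (fun i => f i u.1) (fun i => f i v.1) i).trans_lt
      (hfδ u.1 (by simpa using (hl u hu).1.1) v.1 (by simpa using (hl v hv).1.1)
        (((hl u hu).2 v hv).trans_lt hNδ))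
  obtain ⟨v, hv, w, hw, hvw⟩ := exists_ne_of_cupCoboundary_ne_zero ss l hcup _
    (List.mem_ofFn.2 ⟨i, rfl⟩)
  have h₁ := abs_lt.1 (hclose v hv)
  have h₂ := abs_lt.1 (hclose w hw)
  rcases exists_nonneg_nonpos_of_oddSign_ne hvw with ⟨h₃, h₄⟩ | ⟨h₃, h₄⟩ <;>
    exact abs_le.2 ⟨by linarith [h₁.1, h₁.2, h₂.1, h₂.2], by linarith [h₁.1, h₁.2, h₂.1, h₂.2]⟩

end Cube

section Multilinear

variable {α : Type*} [Fintype α] [DecidableEq α]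

/-- The probability of `T` under the product distribution on `{-1, 1}^α` with mean `x`. -/
noncomputable def cubeWeight (x : α → ℝ) (T : Finset α) : ℝ :=
  ∏ q, if q ∈ T then (1 + x q) / 2 else (1 - x q) / 2

/-- The multilinear extension of a set function to the cube `[-1, 1]^α`. -/
noncomputable def multilinearExtension (g : Finset α → ℝ) (x : α → ℝ) : ℝ :=
  ∑ T, cubeWeight x T * g T

lemma sum_cubeWeight (x : α → ℝ) : ∑ T, cubeWeight x T = 1 := by
  have h : ∏ q, ((1 + x q) / 2 + (1 - x q) / 2) = 1 :=
    Finset.prod_eq_one fun q _ => by ring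
  rw [← h, Fintype.prod_add]
  refine Finset.sum_congr rfl fun T _ => ?_
  rw [cubeWeight, Finset.prod_ite]
  congr 2 <;> ext <;> simp

lemma cubeWeight_nonneg {x : α → ℝ} (hx : ‖x‖ ≤ 1) (T : Finset α) : 0 ≤ cubeWeight x T := by
  rw [pi_norm_le_iff_of_nonneg zero_le_one] at hx
  refine Finset.prod_nonneg fun q _ => ?_
  obtain ⟨h₁, h₂⟩ := abs_le.1 (hx q)
  split_ifs <;> linarith

lemma continuous_multilinearExtension (g : Finset α → ℝ) :
    Continuous (multilinearExtension g) := by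
  refine continuous_finsetSum _ fun T _ => Continuous.mul ?_ continuous_const
  refine continuous_finsetProd _ fun q _ => ?_
  split_ifs <;> fun_prop

lemma multilinearExtension_neg {g : Finset α → ℝ} (hg : ∀ T, g Tᶜ = -g T) (x : α → ℝ) :
    multilinearExtension g (-x) = -multilinearExtension g x := by
  rw [multilinearExtension, multilinearExtension, ← Finset.sum_neg_distrib]
  refine Fintype.sum_equiv (compl_involutive (α := Finset α)).toPerm _ _ fun T => ?_
  have h : cubeWeight (-x) T = cubeWeight x Tᶜ := by
    refine Finset.prod_congr rfl fun q _ => ?_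
    by_cases hq : q ∈ T <;> simp [hq, sub_eq_add_neg]
  simp [h, hg]

lemma multilinearExtension_of_vertex (g : Finset α → ℝ) {x : α → ℝ} (hx : fractional x = ∅) :
    multilinearExtension g x = g (Finset.univ.filter fun q => x q = 1) := by
  have hx' : ∀ q, x q = 1 ∨ x q = -1 := fun q => by
    have : q ∉ fractional x := by simp [hx]
    rw [mem_fractional, not_not] at this
    exact eq_or_eq_neg_of_abs_eq this
  have hw : cubeWeight x (Finset.univ.filter fun q => x q = 1) = 1 := by
    refine Finset.prod_eq_one fun q _ => ?_
    rcases hx' q with h | h <;> norm_num [h]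
  rw [multilinearExtension, Finset.sum_eq_single (Finset.univ.filter fun q => x q = 1), hw,
    one_mul]
  · intro T _ hT
    obtain ⟨q, hq⟩ : ∃ q, ¬ (q ∈ T ↔ x q = 1) := by
      by_contra! h
      exact hT (by ext q; simp [h q])
    rw [cubeWeight, Finset.prod_eq_zero (Finset.mem_univ q), zero_mul]
    rcases hx' q with h | h
    · have : q ∉ T := by tauto
      simp [this, h]
    · have : q ∈ T := by
        by_contra hqT
        exact hq ⟨fun h => absurd h hqT, fun h' => by linarith⟩
      simp [this, h]
  · simp

lemma cubeWeight_update (x : α → ℝ) (q : α) (t : ℝ) (T : Finset α) :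
    cubeWeight (Function.update x q t) T = (if q ∈ T then (1 + t) / 2 else (1 - t) / 2) *
      ∏ p ∈ Finset.univ.erase q, if p ∈ T then (1 + x p) / 2 else (1 - x p) / 2 := by
  rw [cubeWeight, ← Finset.mul_prod_erase _ _ (Finset.mem_univ q), Function.update_self]
  congr 1
  refine Finset.prod_congr rfl fun p hp => ?_
  rw [Function.update_of_ne (Finset.ne_of_mem_erase hp)]

lemma multilinearExtension_update (g : Finset α → ℝ) (x : α → ℝ) (q : α) (t : ℝ) :
    multilinearExtension g (Function.update x q t) =
      (1 + t) / 2 * multilinearExtension g (Function.update x q 1) +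
        (1 - t) / 2 * multilinearExtension g (Function.update x q (-1)) := by
  simp only [multilinearExtension, Finset.mul_sum, ← Finset.sum_add_distrib, cubeWeight_update]
  refine Finset.sum_congr rfl fun T _ => ?_
  split_ifs <;> ring

lemma norm_update_le {x : α → ℝ} (hx : ‖x‖ ≤ 1) (q : α) {t : ℝ} (ht : |t| ≤ 1) :
    ‖Function.update x q t‖ ≤ 1 := by
  rw [pi_norm_le_iff_of_nonneg zero_le_one] at hx ⊢
  intro p
  rcases eq_or_ne p q with rfl | hp
  · simpa using ht
  · simpa [hp] using hx p

lemma abs_multilinearExtension_update_sub_le {g : Finset α → ℝ} {c : ℝ}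
    (hg : ∀ T q, |g T - g (symmDiff T {q})| ≤ c) {x : α → ℝ} (hx : ‖x‖ ≤ 1) (q : α) :
    |multilinearExtension g (Function.update x q 1) -
      multilinearExtension g (Function.update x q (-1))| ≤ c := by
  have hw : ∀ T, cubeWeight (Function.update x q (-1)) (symmDiff T {q}) =
      cubeWeight (Function.update x q 1) T := by
    intro T
    rw [cubeWeight_update, cubeWeight_update]
    congr 1
    · by_cases hq : q ∈ T <;> simp [Finset.mem_symmDiff, hq]
    · refine Finset.prod_congr rfl fun p hp => ?_
      have hp := Finset.ne_of_mem_erase hp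
      simp [Finset.mem_symmDiff, hp]
  have h : multilinearExtension g (Function.update x q (-1)) =
      ∑ T, cubeWeight (Function.update x q 1) T * g (symmDiff T {q}) := by
    refine (Fintype.sum_equiv (symmDiff_right_involutive {q}).toPerm _ _ fun T => ?_).symm
    change _ = cubeWeight _ (symmDiff {q} T) * g (symmDiff {q} T)
    rw [symmDiff_comm {q} T, hw]
  have hnn := cubeWeight_nonneg (norm_update_le hx q (t := 1) (by simp))
  rw [h, multilinearExtension, ← Finset.sum_sub_distrib]
  calc |∑ T, (cubeWeight (Function.update x q 1) T * g T -
        cubeWeight (Function.update x q 1) T * g (symmDiff T {q}))|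
      ≤ ∑ T, cubeWeight (Function.update x q 1) T * c := by
        refine (Finset.abs_sum_le_sum_abs _ _).trans (Finset.sum_le_sum fun T _ => ?_)
        rw [← mul_sub, abs_mul, abs_of_nonneg (hnn T)]
        exact mul_le_mul_of_nonneg_left (hg T q) (hnn T)
    _ = c := by rw [← Finset.sum_mul, sum_cubeWeight, one_mul]

end Multilinear

section Rounding

/-- A two-point form of Hoeffding's lemma. -/
lemma two_point_exp_le {p r a b c : ℝ} (hp : 0 ≤ p) (hr : 0 ≤ r) (hpr : p + r = 1)
    (hab : |a - b| ≤ c) :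
    p * Real.exp a + r * Real.exp b ≤ Real.exp (c ^ 2 / 2) * Real.exp (p * a + r * b) := by
  have hconv := convexOn_exp.2 (Set.mem_univ (-a)) (Set.mem_univ (-b)) hp hr hpr
  simp only [smul_eq_mul] at hconv
  have hcosh : Real.cosh (a - b) ≤ Real.exp (c ^ 2 / 2) :=
    (Real.cosh_le_exp_half_sq _).trans
      (Real.exp_le_exp.2 (by have := sq_le_sq' (abs_le.1 hab).1 (abs_le.1 hab).2; linarith))
  have hprod : (p * Real.exp a + r * Real.exp b) * (p * Real.exp (-a) + r * Real.exp (-b)) ≤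
      Real.cosh (a - b) := by
    have h₁ : Real.exp a * Real.exp (-a) = 1 := by rw [← Real.exp_add]; simp
    have h₂ : Real.exp b * Real.exp (-b) = 1 := by rw [← Real.exp_add]; simp
    have h₃ : Real.exp a * Real.exp (-b) + Real.exp b * Real.exp (-a) =
        2 * Real.cosh (a - b) := by
      rw [Real.cosh_eq, ← Real.exp_add, ← Real.exp_add]
      ring_nf
    have h₄ := Real.one_le_cosh (a - b)
    calc _ = p ^ 2 * (Real.exp a * Real.exp (-a)) + r ^ 2 * (Real.exp b * Real.exp (-b)) +
          p * r * (Real.exp a * Real.exp (-b) + Real.exp b * Real.exp (-a)) := by ring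
      _ = p ^ 2 + r ^ 2 + 2 * (p * r) * Real.cosh (a - b) := by rw [h₁, h₂, h₃]; ring
      _ ≤ (p + r) ^ 2 * Real.cosh (a - b) := by nlinarith [sq_nonneg p, sq_nonneg r]
      _ = Real.cosh (a - b) := by rw [hpr]; ring
  have hnn : 0 ≤ p * Real.exp a + r * Real.exp b := by positivity
  have h₅ := (mul_le_mul_of_nonneg_left hconv hnn).trans (hprod.trans hcosh)
  rw [show p * -a + r * -b = -(p * a + r * b) by ring, Real.exp_neg, ← div_eq_mul_inv,
    div_le_iff₀ (Real.exp_pos _)] at h₅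
  exact h₅

variable {α : Type*} [Fintype α] [DecidableEq α]

/-- Derandomised rounding of a point of the cube to a vertex. -/
lemma exists_vertex_sum_exp_le {ι : Type*} [Fintype ι] (g : ι → Finset α → ℝ) {c : ℝ}
    (hg : ∀ i T q, |g i T - g i (symmDiff T {q})| ≤ c) (x : α → ℝ) (hx : ‖x‖ ≤ 1) :
    ∃ S, ∑ i, Real.exp (g i S) ≤ Real.exp (c ^ 2 / 2) ^ (fractional x).card *
      ∑ i, Real.exp (multilinearExtension (g i) x) := by
  induction hk : (fractional x).card generalizing x with
  | zero =>
    rw [Finset.card_eq_zero] at hk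
    exact ⟨Finset.univ.filter fun q => x q = 1, by
      simp only [multilinearExtension_of_vertex _ hk, pow_zero, one_mul, le_refl]⟩
  | succ k ih =>
    obtain ⟨q, hq⟩ : (fractional x).Nonempty := Finset.card_pos.1 (by omega)
    have hcard : ∀ t : ℝ, |t| = 1 → (fractional (Function.update x q t)).card = k := by
      intro t ht
      rw [show fractional (Function.update x q t) = (fractional x).erase q by
        ext p
        rcases eq_or_ne p q with rfl | hp
        · simp [mem_fractional, ht]
        · simp [mem_fractional, hp], Finset.card_erase_of_mem hq, hk, Nat.add_sub_cancel]
    obtain ⟨h₁, h₂⟩ := abs_le.1 ((norm_le_pi_norm x q).trans hx)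
    set A := ∑ i, Real.exp (multilinearExtension (g i) (Function.update x q 1))
    set B := ∑ i, Real.exp (multilinearExtension (g i) (Function.update x q (-1)))
    set D := Real.exp (c ^ 2 / 2) * ∑ i, Real.exp (multilinearExtension (g i) x)
    have havg : (1 + x q) / 2 * A + (1 - x q) / 2 * B ≤ D := by
      simp only [A, B, D, Finset.mul_sum, ← Finset.sum_add_distrib]
      refine Finset.sum_le_sum fun i _ => ?_
      have h := multilinearExtension_update (g i) x q (x q)
      rw [Function.update_eq_self] at h
      rw [h]
      exact two_point_exp_le (by linarith) (by linarith) (by ring)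
        (abs_multilinearExtension_update_sub_le (hg i) hx q)
    have hmin : A ≤ D ∨ B ≤ D := by
      by_contra! h
      have hm := lt_min h.1 h.2
      have hA := mul_le_mul_of_nonneg_left (min_le_left A B) (by linarith : 0 ≤ (1 + x q) / 2)
      have hB := mul_le_mul_of_nonneg_left (min_le_right A B) (by linarith : 0 ≤ (1 - x q) / 2)
      linarith
    have hpow : (0 : ℝ) ≤ Real.exp (c ^ 2 / 2) ^ k := by positivity
    rcases hmin with h | h
    · obtain ⟨S, hS⟩ := ih _ (norm_update_le hx q (t := 1) (by simp)) (hcard 1 (by simp))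
      refine ⟨S, hS.trans ?_⟩
      rw [pow_succ (Real.exp (c ^ 2 / 2)), mul_assoc]
      exact mul_le_mul_of_nonneg_left h hpow
    · obtain ⟨S, hS⟩ := ih _ (norm_update_le hx q (t := -1) (by simp)) (hcard (-1) (by simp))
      refine ⟨S, hS.trans ?_⟩
      rw [pow_succ (Real.exp (c ^ 2 / 2)), mul_assoc]
      exact mul_le_mul_of_nonneg_left h hpow

end Rounding

section Transfer

variable {α : Type*} [Fintype α] [DecidableEq α] {v : Finset α → ℝ} {A : Finset α}

lemma transferAux_le_card {F : Finset α} (h : v (symmDiff A F) ≤ v (symmDiff A F)ᶜ) :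
    transferAux v A Aᶜ ≤ F.card := by
  refine Nat.sInf_le ⟨A ∩ F, F \ A, Finset.inter_subset_left, ?_, ?_, ?_⟩
  · intro q hq
    exact Finset.mem_compl.2 (Finset.mem_sdiff.1 hq).2
  · convert h using 2 <;> ext q <;>
      grind [Finset.mem_symmDiff, Finset.mem_compl]
  · rw [Finset.inter_comm, Finset.card_inter_add_card_sdiff]

lemma exists_card_eq_transferAux (v : Finset α → ℝ) (A : Finset α) (hA : v Aᶜ ≤ v A) :
    ∃ F : Finset α, v (symmDiff A F) ≤ v (symmDiff A F)ᶜ ∧ F.card = transferAux v A Aᶜ := by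
  have hne : {t : ℕ | ∃ S S' : Finset α, S ⊆ A ∧ S' ⊆ Aᶜ ∧
      v ((A \ S) ∪ S') ≤ v ((Aᶜ \ S') ∪ S) ∧ t = S.card + S'.card}.Nonempty :=
    ⟨_, A, Aᶜ, subset_rfl, subset_rfl, by simpa using hA, rfl⟩
  obtain ⟨S, S', hS, hS', h, ht⟩ := Nat.sInf_mem hne
  have hS'A : ∀ q ∈ S', q ∉ A := fun q hq => Finset.mem_compl.1 (hS' hq)
  refine ⟨S ∪ S', ?_, ?_⟩
  · have e₁ : symmDiff A (S ∪ S') = (A \ S) ∪ S' := by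
      ext q
      have h₁ := @hS q
      have h₂ := hS'A q
      simp only [Finset.mem_symmDiff, Finset.mem_union, Finset.mem_sdiff]
      tauto
    have e₂ : (symmDiff A (S ∪ S'))ᶜ = (Aᶜ \ S') ∪ S := by
      ext q
      have h₁ := @hS q
      have h₂ := hS'A q
      simp only [Finset.mem_symmDiff, Finset.mem_union, Finset.mem_sdiff, Finset.mem_compl]
      tauto
    rw [e₂, e₁]
    exact h
  · rw [Finset.card_union_of_disjoint
      (Finset.disjoint_left.2 fun q hq hq' => hS'A q hq' (hS hq))]
    exact ht.symm

lemma transferAux_le_succ {q : α} (hB : v (symmDiff A {q})ᶜ ≤ v (symmDiff A {q})) :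
    transferAux v A Aᶜ ≤ transferAux v (symmDiff A {q}) (symmDiff A {q})ᶜ + 1 := by
  obtain ⟨F, hF, hcard⟩ := exists_card_eq_transferAux v _ hB
  rw [symmDiff_assoc] at hF
  refine (transferAux_le_card hF).trans ?_
  rw [← hcard, add_comm]
  refine (Finset.card_le_card ?_).trans (Finset.card_union_le {q} F)
  exact symmDiff_le_sup

lemma transferAux_le_one {q : α} (hB : v (symmDiff A {q}) ≤ v (symmDiff A {q})ᶜ) :
    transferAux v A Aᶜ ≤ 1 := by
  simpa using transferAux_le_card hB

/-- The transfer imbalance of the bipartition `{A, Aᶜ}`, with the sign of `v A - v Aᶜ`. -/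
noncomputable def signedImbalance (v : Finset α → ℝ) (A : Finset α) : ℝ :=
  if v Aᶜ ≤ v A then transferAux v A Aᶜ else -transferAux v Aᶜ A

lemma abs_signedImbalance (v : Finset α → ℝ) (A : Finset α) :
    |signedImbalance v A| = transferImbalance v A Aᶜ := by
  rw [signedImbalance, transferImbalance]
  split_ifs <;> simp

lemma signedImbalance_compl (v : Finset α → ℝ) (A : Finset α) :
    signedImbalance v Aᶜ = -signedImbalance v A := by
  rw [signedImbalance, signedImbalance, compl_compl]
  rcases lt_trichotomy (v A) (v Aᶜ) with h | h | h
  · simp [h.le, h.not_ge]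
  · have h₁ : transferAux v A Aᶜ = 0 := by
      simpa using transferAux_le_card (v := v) (A := A) (F := ∅)
        (by simpa [← Finset.bot_eq_empty] using h.le)
    have h₂ : transferAux v Aᶜ A = 0 := by
      simpa using transferAux_le_card (v := v) (A := Aᶜ) (F := ∅)
        (by simpa [← Finset.bot_eq_empty] using h.ge)
    simp [h, h₁, h₂]
  · simp [h.le, h.not_ge]

lemma signedImbalance_sub_le (v : Finset α → ℝ) (A : Finset α) (q : α) :
    signedImbalance v A - signedImbalance v (symmDiff A {q}) ≤ 2 := by
  set B := symmDiff A {q} with hAB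
  have hBA : symmDiff Bᶜ {q} = Aᶜ := by
    ext p
    simp only [hAB, Finset.mem_compl, Finset.mem_symmDiff]
    tauto
  by_cases hA : v Aᶜ ≤ v A <;> by_cases hB : v Bᶜ ≤ v B
  · rw [signedImbalance, signedImbalance, if_pos hA, if_pos hB]
    have h : (transferAux v A Aᶜ : ℝ) ≤ transferAux v B Bᶜ + 1 := by
      exact_mod_cast transferAux_le_succ hB
    linarith
  · rw [signedImbalance, signedImbalance, if_pos hA, if_neg hB]
    have h₁ : (transferAux v A Aᶜ : ℝ) ≤ 1 := by
      exact_mod_cast transferAux_le_one (not_le.1 hB).le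
    have h₂ : (transferAux v Bᶜ Bᶜᶜ : ℝ) ≤ 1 := by
      exact_mod_cast transferAux_le_one (q := q) (by rwa [hBA, compl_compl])
    rw [compl_compl] at h₂
    linarith
  · rw [signedImbalance, signedImbalance, if_neg hA, if_pos hB]
    have h₁ : (0 : ℝ) ≤ transferAux v Aᶜ A := Nat.cast_nonneg _
    have h₂ : (0 : ℝ) ≤ transferAux v B Bᶜ := Nat.cast_nonneg _
    linarith
  · rw [signedImbalance, signedImbalance, if_neg hA, if_neg hB]
    have h : (transferAux v Bᶜ Bᶜᶜ : ℝ) ≤ transferAux v Aᶜ Aᶜᶜ + 1 := by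
      rw [← hBA]
      exact_mod_cast transferAux_le_succ (q := q)
        (by rw [hBA, compl_compl]; exact (not_le.1 hA).le)
    rw [compl_compl, compl_compl] at h
    linarith

lemma abs_signedImbalance_sub_le (v : Finset α → ℝ) (A : Finset α) (q : α) :
    |signedImbalance v A - signedImbalance v (symmDiff A {q})| ≤ 2 := by
  refine abs_sub_le_iff.2 ⟨signedImbalance_sub_le v A q, ?_⟩
  simpa [symmDiff_assoc] using signedImbalance_sub_le v (symmDiff A {q}) q

end Transfer

/-- **Upper bound on the two-color transfer-discrepancy.**
There is a universal constant `C > 0` such that for every finite item set and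
every family of `n ≥ 2` arbitrary valuation functions (no marginal bound, no
monotonicity), there is a bipartition `M = S ∪ Sᶜ` with
`T_{v i}(S, Sᶜ) ≤ C * √(n * log (2 * n))` for every agent `i`;
i.e. `discᵀ(V, 2) ≤ C * √(n * log (2 * n))`. -/
theorem transfer_discrepancy_upper_bound :
    ∃ C : ℝ, 0 < C ∧
      ∀ (n : ℕ), 2 ≤ n →
      ∀ (α : Type) [Fintype α] [DecidableEq α]
        (v : Fin n → Finset α → ℝ),
        ∃ S : Finset α,
          ∀ i : Fin n,
            (transferImbalance (v i) S Sᶜ : ℝ) ≤ C * Real.sqrt (n * Real.log (2 * n)) := by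
  refine ⟨4, by norm_num, fun n hn α _ _ v => ?_⟩
  have hn' : (2 : ℝ) ≤ n := by exact_mod_cast hn
  have hlog : 1 / 2 ≤ Real.log (2 * n) := by
    have h₁ := Real.log_two_gt_d9
    have h₂ : Real.log 2 ≤ Real.log (2 * n) := Real.log_le_log two_pos (by linarith)
    linarith
  set L := Real.log (2 * n) with hL
  obtain ⟨x, hx, hcard, hsmall⟩ := exists_abs_le_of_odd
    (fun i => multilinearExtension (signedImbalance (v i)))
    (fun i => continuous_multilinearExtension _)
    (fun i => multilinearExtension_neg (signedImbalance_compl (v i))) one_pos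
  set c := Real.sqrt (L / n) with hc
  have hcpos : 0 < c := Real.sqrt_pos.2 (by positivity)
  have hcsq : c ^ 2 = L / n := Real.sq_sqrt (by positivity)
  obtain ⟨S, hS⟩ := exists_vertex_sum_exp_le
    (fun (j : Fin n × ℤˣ) T => ((j.2 : ℤ) : ℝ) * c * signedImbalance (v j.1) T) (c := 2 * c)
    (fun j T q => by
      have hj : |((j.2 : ℤ) : ℝ)| = 1 := by
        rcases Int.units_eq_one_or j.2 with h | h <;> simp [h]
      rw [← mul_sub, abs_mul, abs_mul, hj, abs_of_pos hcpos, one_mul, mul_comm]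
      exact mul_le_mul_of_nonneg_right (abs_signedImbalance_sub_le _ _ _) hcpos.le) x hx
  refine ⟨S, fun i => ?_⟩
  have hext : ∀ (a : ℝ) (g : Finset α → ℝ),
      multilinearExtension (fun T => a * g T) x = a * multilinearExtension g x := fun a g => by
    simp only [multilinearExtension, Finset.mul_sum]
    exact Finset.sum_congr rfl fun T _ => by ring
  have hsum : ∑ j : Fin n × ℤˣ, Real.exp (multilinearExtension
      (fun T => ((j.2 : ℤ) : ℝ) * c * signedImbalance (v j.1) T) x) ≤ 2 * n * Real.exp c := by
    calc _ ≤ ∑ j : Fin n × ℤˣ, Real.exp c := by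
          refine Finset.sum_le_sum fun j _ => Real.exp_le_exp.2 ?_
          have hj : |((j.2 : ℤ) : ℝ)| = 1 := by
            rcases Int.units_eq_one_or j.2 with h | h <;> simp [h]
          rw [hext]
          refine (le_abs_self _).trans ?_
          rw [abs_mul, abs_mul, hj, abs_of_pos hcpos, one_mul]
          exact mul_le_of_le_one_right hcpos.le (hsmall j.1)
      _ = 2 * n * Real.exp c := by
          simp [Fintype.card_prod, mul_comm]
  have hpow : Real.exp ((2 * c) ^ 2 / 2) ^ (fractional x).card ≤ Real.exp (2 * L) := by
    have h : (1 : ℝ) ≤ Real.exp ((2 * c) ^ 2 / 2) := Real.one_le_exp (by positivity)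
    refine (pow_le_pow_right₀ h hcard).trans ?_
    rw [← Real.exp_nat_mul, Real.exp_le_exp, mul_pow, hcsq]
    have : (n : ℝ) * (2 ^ 2 * (L / n) / 2) = 2 * L := by field_simp
    exact this.le
  have hbound : ∀ u : ℤˣ, ((u : ℤ) : ℝ) * c * signedImbalance (v i) S ≤ 3 * L + c := by
    intro u
    rw [← Real.exp_le_exp]
    refine (Finset.single_le_sum (f := fun j : Fin n × ℤˣ =>
      Real.exp (((j.2 : ℤ) : ℝ) * c * signedImbalance (v j.1) S))
      (fun j _ => (Real.exp_pos _).le) (Finset.mem_univ (i, u))).trans (hS.trans ?_)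
    refine (mul_le_mul hpow hsum (Finset.sum_nonneg fun j _ => (Real.exp_pos _).le)
      (Real.exp_pos _).le).trans_eq ?_
    rw [show 3 * L + c = 2 * L + (L + c) by ring, Real.exp_add, Real.exp_add L, hL,
      Real.exp_log (by positivity)]
  have habs : c * |signedImbalance (v i) S| ≤ 3 * L + c := by
    have h₁ := hbound 1
    have h₂ := hbound (-1)
    rw [← abs_of_pos hcpos, ← abs_mul, abs_of_pos hcpos]
    refine abs_le.2 ⟨?_, ?_⟩ <;> push_cast at h₁ h₂ <;> linarith
  rw [← abs_signedImbalance]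
  have hsqrt : Real.sqrt (n * L) = c * n := by
    rw [Real.sqrt_eq_iff_mul_self_eq (by positivity) (by positivity)]
    rw [show c * n * (c * n) = c ^ 2 * n * n by ring, hcsq]
    field_simp
  have hone : 1 ≤ c * n := by
    rw [← hsqrt, Real.one_le_sqrt]
    nlinarith
  have hL' : L = c * (c * n) := by
    rw [← mul_assoc, ← sq, hcsq]
    field_simp
  rw [hsqrt]
  have : c * |signedImbalance (v i) S| ≤ c * (3 * (c * n) + 1) := by
    rw [hL'] at habs
    linarith
  linarith [le_of_mul_le_mul_left this hcpos]
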